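/- arXiv:1209.3759 — 4 statements merged into one kernel-verified Lean document; each statement's English description precedes it below -/
import Mathlib

section
/- On the complete graph K_n with n ≥ 2 vertices, the undirected TSP independence system is a p-system with p = 2 − 1/⌊(n+1)/2⌋ < 2: for every subset A of the edge set, the size of every basis of A is at most (2 − 1/⌊(n+1)/2⌋) times the size of every other basis of A. -/
/-- Degree of a vertex in an edge set. -/
def degIn {V : Type*} [DecidableEq V] (S : Finset (Sym2 V)) (v : V) : ℕ :=
  (S.filter (fun e => v ∈ e)).card

/-- `S` is the edge set of a Hamiltonian cycle of the complete graph on `V`. -/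
def IsTour {V : Type*} [DecidableEq V] (S : Finset (Sym2 V)) : Prop :=
  ∃ (v : V) (w : (SimpleGraph.fromEdgeSet (S : Set (Sym2 V))).Walk v v),
    w.IsHamiltonianCycle ∧ S = w.edges.toFinset

/-- The undirected TSP independence system on the complete graph `K_n`. -/
def TSPIndep {V : Type*} [DecidableEq V] (S : Finset (Sym2 V)) : Prop :=
  (∀ e ∈ S, ¬ e.IsDiag) ∧ (∀ v : V, degIn S v ≤ 2) ∧
  ((SimpleGraph.fromEdgeSet (S : Set (Sym2 V))).IsAcyclic ∨ IsTour S)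

/-- `B` is a basis of `A`: an inclusion-maximal member of `ℱ` contained in `A`. -/
def IsBasisOf {α : Type*} (ℱ : Set (Finset α)) (A B : Finset α) : Prop :=
  B ∈ ℱ ∧ B ⊆ A ∧ ∀ B' ∈ ℱ, B' ⊆ A → B ⊆ B' → B' = B

namespace SimpleGraph

variable {V : Type*} {G : SimpleGraph V}

/-- In a graph with at most two neighbours per vertex, two paths that continue past the same edge
`u v` and end in vertices with at most one neighbour have the same end. -/
theorem Walk.IsPath.end_eq_of_subsingleton_neighborSet
    (hG : ∀ v a b c, G.Adj v a → G.Adj v b → G.Adj v c → a = b ∨ a = c ∨ b = c)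
    {u v x y : V} {p : G.Walk v x} {q : G.Walk v y} (hp : p.IsPath) (hq : q.IsPath)
    (huv : G.Adj u v) (hup : u ∉ p.support) (huq : u ∉ q.support)
    (hx : (G.neighborSet x).Subsingleton) (hy : (G.neighborSet y).Subsingleton) : x = y := by
  induction p generalizing u with
  | nil =>
    cases q with
    | nil => rfl
    | cons h q =>
      have := hx h huv.symm
      subst this
      simp at huq
  | @cons v a x h p ih =>
    cases q with
    | nil =>
      have := hy h huv.symm
      subst this
      simp at hup
    | @cons _ b _ h' q =>
      rw [Walk.cons_isPath_iff] at hp hq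
      rw [Walk.support_cons, List.mem_cons, not_or] at hup huq
      obtain hab | hau | hbu := hG v a b u h h' huv.symm
      · subst hab
        exact ih hp.1 hq.1 h hp.2 hq.2 hx
      · subst hau
        exact absurd p.start_mem_support hup.2
      · subst hbu
        exact absurd q.start_mem_support huq.2

/-- In a graph with at most two neighbours per vertex, a vertex with at most one neighbour reaches
at most one other such vertex. -/
theorem eq_of_reachable_of_subsingleton_neighborSet
    (hG : ∀ v a b c, G.Adj v a → G.Adj v b → G.Adj v c → a = b ∨ a = c ∨ b = c)
    {v x y : V} (hvx : G.Reachable v x) (hvy : G.Reachable v y) (hx' : v ≠ x) (hy' : v ≠ y)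
    (hv : (G.neighborSet v).Subsingleton)
    (hx : (G.neighborSet x).Subsingleton) (hy : (G.neighborSet y).Subsingleton) : x = y := by
  obtain ⟨p, hp⟩ := hvx.exists_isPath
  obtain ⟨q, hq⟩ := hvy.exists_isPath
  cases p with
  | nil => exact absurd rfl hx'
  | @cons _ a _ h p =>
    cases q with
    | nil => exact absurd rfl hy'
    | @cons _ b _ h' q =>
      obtain rfl := hv h h'
      rw [Walk.cons_isPath_iff] at hp hq
      exact hp.1.end_eq_of_subsingleton_neighborSet hG hq.1 h hp.2 hq.2 hx hy

/-- A finite acyclic graph with an edge has a leaf. -/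
theorem IsAcyclic.exists_existsUnique_adj [Finite V] (h : G.IsAcyclic) {a b : V}
    (hab : G.Adj a b) : ∃ v, ∃! w, G.Adj v w := by
  have : Nonempty V := ⟨a⟩
  obtain ⟨u, v, p, hp, hmax⟩ := Walk.exists_isPath_forall_isPath_length_le_length G
  have hnil : ¬p.Nil := by
    have h1 := hmax _ _ (Walk.cons hab Walk.nil) (by simp [Walk.cons_isPath_iff, hab.ne])
    intro h0
    rw [Walk.length_eq_zero_iff.mpr h0] at h1
    simp at h1
  refine ⟨u, _, p.adj_snd hnil, fun w hadj ↦ h.eq_snd_of_adj_start hp hadj ?_⟩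
  by_contra hw
  have := hmax _ _ (p.cons hadj.symm) (hp.cons hw)
  simp at this

end SimpleGraph

section Degrees

variable {V : Type*} [DecidableEq V]

theorem subsingleton_neighborSet_of_degIn_le_one {S : Finset (Sym2 V)} {v : V}
    (h : degIn S v ≤ 1) :
    ((SimpleGraph.fromEdgeSet (S : Set (Sym2 V))).neighborSet v).Subsingleton := by
  intro a ha b hb
  simp only [SimpleGraph.mem_neighborSet, SimpleGraph.fromEdgeSet_adj, Finset.mem_coe] at ha hb
  have := Finset.card_le_one.mp h s(v, a) (by simp [ha.1]) s(v, b) (by simp [hb.1])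
  grind

theorem neighbors_eq_of_degIn_le_two {S : Finset (Sym2 V)} {v a b c : V} (h : degIn S v ≤ 2)
    (ha : (SimpleGraph.fromEdgeSet (S : Set (Sym2 V))).Adj v a)
    (hb : (SimpleGraph.fromEdgeSet (S : Set (Sym2 V))).Adj v b)
    (hc : (SimpleGraph.fromEdgeSet (S : Set (Sym2 V))).Adj v c) : a = b ∨ a = c ∨ b = c := by
  simp only [SimpleGraph.fromEdgeSet_adj, Finset.mem_coe] at ha hb hc
  by_contra! hne
  refine h.not_gt (Finset.two_lt_card.mpr ⟨s(v, a), by simp [ha.1], s(v, b), by simp [hb.1],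
    s(v, c), by simp [hc.1], ?_⟩)
  grind

theorem degIn_pos_of_adj {S : Finset (Sym2 V)} {v w : V}
    (h : (SimpleGraph.fromEdgeSet (S : Set (Sym2 V))).Adj v w) : 0 < degIn S v :=
  Finset.card_pos.mpr ⟨s(v, w), Finset.mem_filter.mpr ⟨((SimpleGraph.fromEdgeSet_adj _).mp h).1, by simp⟩⟩

theorem exists_degIn_eq_one [Finite V] {S : Finset (Sym2 V)} (hS : ∀ e ∈ S, ¬ e.IsDiag)
    (hac : (SimpleGraph.fromEdgeSet (S : Set (Sym2 V))).IsAcyclic) (hne : S.Nonempty) :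
    ∃ v, degIn S v = 1 := by
  obtain ⟨e, he⟩ := hne
  induction e with
  | h a b =>
    have hab : (SimpleGraph.fromEdgeSet (S : Set (Sym2 V))).Adj a b := by
      simpa using ⟨he, hS _ he⟩
    obtain ⟨v, w, hvw, hw⟩ := hac.exists_existsUnique_adj hab
    refine ⟨v, le_antisymm (Finset.card_le_one.mpr ?_) (degIn_pos_of_adj hvw)⟩
    have key : ∀ e ∈ S.filter (fun e => v ∈ e), e = s(v, w) := by
      intro e he
      obtain ⟨heS, hve⟩ := Finset.mem_filter.mp he
      obtain ⟨x, rfl⟩ := hve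
      have hvx : v ≠ x := by simpa using hS _ heS
      rw [hw x (by simpa using ⟨heS, hvx⟩)]
    intro e he f hf
    rw [key e he, key f hf]

theorem sum_degIn_eq_of_forall_mem {S : Finset (Sym2 V)} (hS : ∀ e ∈ S, ¬ e.IsDiag)
    {T : Finset V} (hT : ∀ e ∈ S, ∀ v ∈ e, v ∈ T) : ∑ v ∈ T, degIn S v = 2 * S.card := by
  have h := Finset.sum_card_bipartiteAbove_eq_sum_card_bipartiteBelow (s := T) (t := S)
    (fun (v : V) e => v ∈ e)
  refine h.trans ?_
  rw [mul_comm, ← smul_eq_mul, ← Finset.sum_const]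
  refine Finset.sum_congr rfl fun e he => ?_
  rw [← Sym2.card_toFinset_of_not_isDiag e (hS e he)]
  congr 1
  ext v
  simpa [Finset.bipartiteBelow] using hT e he v

/-- A set of edges with all degrees at most two has at most as many edges as there are vertices. -/
theorem card_le_card_of_degIn_le_two [Fintype V] {S : Finset (Sym2 V)}
    (hS : ∀ e ∈ S, ¬ e.IsDiag) (hd : ∀ v, degIn S v ≤ 2) : S.card ≤ Fintype.card V := by
  have h := sum_degIn_eq_of_forall_mem hS (T := Finset.univ) (by simp)
  have h2 := Finset.sum_le_card_nsmul Finset.univ (degIn S) 2 (fun v _ => hd v)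
  rw [h, Finset.card_univ, smul_eq_mul] at h2
  omega

theorem degIn_insert_le (S : Finset (Sym2 V)) (e : Sym2 V) (v : V) :
    degIn (insert e S) v ≤ degIn S v + if v ∈ e then 1 else 0 := by
  unfold degIn
  rw [Finset.filter_insert]
  split_ifs
  · exact Finset.card_insert_le _ _
  · simp

/-- An edge of `A` joining two vertices of degree at most one in an acyclic basis of `A` has its
ends in the same component of that basis. -/
theorem IsBasisOf.reachable_of_degIn_le_one {A B : Finset (Sym2 V)} (hA : ∀ e ∈ A, ¬ e.IsDiag)
    (hB : IsBasisOf {S | TSPIndep S} A B)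
    (hac : (SimpleGraph.fromEdgeSet (B : Set (Sym2 V))).IsAcyclic)
    {a b : V} (hab : s(a, b) ∈ A) (ha : degIn B a ≤ 1) (hb : degIn B b ≤ 1) :
    (SimpleGraph.fromEdgeSet (B : Set (Sym2 V))).Reachable a b := by
  obtain ⟨⟨hdiag, hdeg, -⟩, hBA, hmax⟩ := hB
  by_contra hr
  have hins : insert s(a, b) B = B := by
    refine hmax _ ⟨?_, fun v => ?_, Or.inl ?_⟩ ?_ (Finset.subset_insert _ _)
    · simpa using ⟨hA _ hab, hdiag⟩
    · refine (degIn_insert_le B s(a, b) v).trans ?_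
      split_ifs with hv
      · rcases Sym2.mem_iff.mp hv with rfl | rfl <;> omega
      · exact hdeg v
    · have := hac.sup_edge_of_not_reachable hr
      rwa [SimpleGraph.edge, ← SimpleGraph.fromEdgeSet_union, Set.union_singleton,
        ← Finset.coe_insert] at this
    · exact Finset.insert_subset hab hBA
  refine hr (SimpleGraph.Adj.reachable ?_)
  have hne : a ≠ b := by simpa using hA _ hab
  simpa using ⟨Finset.insert_eq_self.mp hins, hne⟩

/-- Each edge of `J` meets a vertex of degree two in the acyclic basis `B`, or joins the two
degree-one vertices of a component of `B`. -/
theorem IsBasisOf.two_mul_card_add_card_leaves_le [Fintype V] {A B J : Finset (Sym2 V)}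
    (hA : ∀ e ∈ A, ¬ e.IsDiag) (hB : IsBasisOf {S | TSPIndep S} A B)
    (hac : (SimpleGraph.fromEdgeSet (B : Set (Sym2 V))).IsAcyclic)
    (hJA : J ⊆ A) (hJ : ∀ v, degIn J v ≤ 2) :
    2 * J.card + (Finset.univ.filter fun v => degIn B v = 1).card ≤ 4 * B.card := by
  set D₁ := Finset.univ.filter fun v => degIn B v = 1 with hD₁
  set D₂ := Finset.univ.filter fun v => degIn B v = 2 with hD₂
  set L := J.filter fun e => ∀ v ∈ e, degIn B v ≤ 1 with hL
  have hdeg := hB.1.2.1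
  have hreach : ∀ a b, s(a, b) ∈ L →
      (SimpleGraph.fromEdgeSet (B : Set (Sym2 V))).Reachable a b ∧ a ≠ b ∧
        degIn B a ≤ 1 ∧ degIn B b ≤ 1 := by
    intro a b hab
    obtain ⟨habJ, hd⟩ := Finset.mem_filter.mp hab
    exact ⟨hB.reachable_of_degIn_le_one hA hac (hJA habJ) (hd a (by simp)) (hd b (by simp)),
      by simpa using hA _ (hJA habJ), hd a (by simp), hd b (by simp)⟩
  have hBsum : D₁.card + 2 * D₂.card = 2 * B.card := by
    rw [← sum_degIn_eq_of_forall_mem hB.1.1 (T := Finset.univ) (by simp), hD₁, hD₂,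
      Finset.card_filter, Finset.card_filter, Finset.mul_sum, ← Finset.sum_add_distrib]
    refine Finset.sum_congr rfl fun v _ => ?_
    have := hdeg v
    interval_cases degIn B v <;> rfl
  have hLsum : 2 * L.card ≤ D₁.card := by
    rw [← sum_degIn_eq_of_forall_mem (T := D₁)
      (fun e he => hA e (hJA (Finset.mem_filter.mp he).1)), ← mul_one D₁.card, ← smul_eq_mul]
    · refine Finset.sum_le_card_nsmul _ _ _ fun v _ => Finset.card_le_one.mpr ?_
      intro e he f hf
      obtain ⟨heL, x, rfl⟩ := Finset.mem_filter.mp he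
      obtain ⟨hfL, y, rfl⟩ := Finset.mem_filter.mp hf
      obtain ⟨hrx, hnx, hv, hx⟩ := hreach v x heL
      obtain ⟨hry, hny, -, hy⟩ := hreach v y hfL
      rw [SimpleGraph.eq_of_reachable_of_subsingleton_neighborSet
        (fun w a b c => neighbors_eq_of_degIn_le_two (hdeg w)) hrx hry hnx hny
        (subsingleton_neighborSet_of_degIn_le_one hv)
        (subsingleton_neighborSet_of_degIn_le_one hx)
        (subsingleton_neighborSet_of_degIn_le_one hy)]
    · rintro e he v ⟨x, rfl⟩
      obtain ⟨⟨p⟩, hne, hv, -⟩ := hreach v x he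
      cases p with
      | nil => exact absurd rfl hne
      | cons h p =>
        have := degIn_pos_of_adj h
        simp only [hD₁, Finset.mem_filter, Finset.mem_univ, true_and]
        omega
  have hcover : J ⊆ L ∪ D₂.biUnion fun v => J.filter fun e => v ∈ e := by
    intro e he
    by_cases hd : ∀ v ∈ e, degIn B v ≤ 1
    · exact Finset.mem_union_left _ (Finset.mem_filter.mpr ⟨he, hd⟩)
    · push Not at hd
      obtain ⟨v, hve, hv⟩ := hd
      refine Finset.mem_union_right _ (Finset.mem_biUnion.mpr
        ⟨v, ?_, Finset.mem_filter.mpr ⟨he, hve⟩⟩)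
      simpa [hD₂] using le_antisymm (hdeg v) hv
  have hcard := (Finset.card_le_card hcover).trans (Finset.card_union_le _ _)
  have hD₂J := Finset.card_biUnion_le_card_mul D₂ (fun v => J.filter fun e => v ∈ e) 2
    fun v _ => hJ v
  omega

theorem IsTour.card_eq [Fintype V] {S : Finset (Sym2 V)} (h : IsTour S) :
    S.card = Fintype.card V := by
  obtain ⟨v, w, hw, hS⟩ := h
  rw [hS, List.toFinset_card_of_nodup hw.isCycle.isTrail.edges_nodup, SimpleGraph.Walk.length_edges,
    hw.length_eq]

end Degrees

/-- Jenkyns: on `K_n` (`n ≥ 2`) the undirected TSP independence system is a `p`-system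
with `p = 2 − 1/⌊(n+1)/2⌋ < 2`. -/
theorem tsp_psystem_jenkyns {V : Type*} [Fintype V] [DecidableEq V]
    (hn : 2 ≤ Fintype.card V)
    (A B₁ B₂ : Finset (Sym2 V)) (hA : ∀ e ∈ A, ¬ e.IsDiag)
    (hB₁ : IsBasisOf {S | TSPIndep S} A B₁) (hB₂ : IsBasisOf {S | TSPIndep S} A B₂) :
    (B₁.card : ℝ) ≤ (2 - 1 / (((Fintype.card V + 1) / 2 : ℕ) : ℝ)) * (B₂.card : ℝ) ∧
    (2 - 1 / (((Fintype.card V + 1) / 2 : ℕ) : ℝ)) < 2 := by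
  set k := (Fintype.card V + 1) / 2 with hk
  have hk1 : 1 ≤ k := by omega
  have hk0 : (0 : ℝ) < k := by exact_mod_cast hk1
  refine ⟨?_, by simpa using hk0⟩
  suffices h : B₁.card * k + B₂.card ≤ 2 * k * B₂.card by
    have h' : (B₁.card : ℝ) * k + B₂.card ≤ 2 * k * B₂.card := by exact_mod_cast h
    have h2 : (2 - 1 / (k : ℝ)) * B₂.card = (2 * k * B₂.card - B₂.card) / k := by
      field_simp
    rw [h2, le_div_iff₀ hk0]
    linarith
  have hn₁ : B₁.card ≤ Fintype.card V := card_le_card_of_degIn_le_two hB₁.1.1 hB₁.1.2.1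
  rcases hB₂.1.2.2 with hac | htour
  · have hle := hB₂.two_mul_card_add_card_leaves_le hA hac hB₁.2.1 hB₁.1.2.1
    rcases B₂.eq_empty_or_nonempty with rfl | hne
    · have h0 : B₁.card = 0 := by simp at hle; simp [hle]
      simp [h0]
    · obtain ⟨v, hv⟩ := exists_degIn_eq_one hB₂.1.1 hac hne
      have hpos : 0 < (Finset.univ.filter fun v => degIn B₂ v = 1).card :=
        Finset.card_pos.mpr ⟨v, by simpa using hv⟩
      have h1 : B₁.card + 1 ≤ 2 * B₂.card := by omega
      have h2 : B₁.card ≤ 2 * k := by omega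
      rcases le_or_gt B₂.card k with hb | hb
      · nlinarith
      · obtain ⟨c, hc⟩ := Nat.exists_eq_add_of_lt hb
        rw [hc]
        nlinarith [Nat.mul_le_mul_right k h2, Nat.mul_le_mul_right c hk1]
  · rw [htour.card_eq]
    nlinarith [Nat.mul_le_mul_right k hn₁, Nat.mul_le_mul_left (Fintype.card V) hk1]
end

section
/- Let K_n be the complete graph and let w : 2^E → ℝ≥0 be a monotone, normalized (w(∅) = 0) submodular function with curvature κ ∈ [0,1] on its edge set E. If M is the final set of any greedy sequence for the independence system of simple 2-matchings with objective w, then w(M) ≥ w(M*) / (2 + κ), where M* is a simple 2-matching maximizing w. -/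
/-- A simple 2-matching of the complete graph on `V`. -/
def Matching2 {V : Type*} [DecidableEq V] (S : Finset (Sym2 V)) : Prop :=
  (∀ e ∈ S, ¬ e.IsDiag) ∧ (∀ v : V, degIn S v ≤ 2)

def Submodular {α : Type*} [DecidableEq α] (f : Finset α → ℝ) : Prop :=
  ∀ S T : Finset α, f (S ∪ T) + f (S ∩ T) ≤ f S + f T

def MonotoneFn {α : Type*} (f : Finset α → ℝ) : Prop :=
  ∀ S T : Finset α, S ⊆ T → f S ≤ f T

def HasCurvature {α : Type*} [DecidableEq α] (f : Finset α → ℝ) (κ : ℝ) : Prop :=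
  ∀ (A : Finset α) (e : α), e ∉ A → (1 - κ) * f {e} ≤ f (insert e A) - f A

structure IsGreedySeq {α : Type*} [DecidableEq α] (ℱ : Set (Finset α)) (f : Finset α → ℝ)
    (l : List α) : Prop where
  nodup : l.Nodup
  indep : ∀ t : ℕ, (l.take t).toFinset ∈ ℱ
  greedy : ∀ (t : ℕ) (ht : t < l.length), ∀ e ∉ (l.take t).toFinset,
    insert e (l.take t).toFinset ∈ ℱ →
    f (insert e (l.take t).toFinset) - f (l.take t).toFinset ≤
      f (insert (l.get ⟨t, ht⟩) (l.take t).toFinset) - f (l.take t).toFinset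
  maximal : ∀ e ∉ l.toFinset, insert e l.toFinset ∉ ℱ

section SetFunction

variable {α : Type*} [DecidableEq α] {f : Finset α → ℝ}

/-- Diminishing marginal gains of a monotone submodular function. -/
theorem Submodular.marginal_anti (hsub : Submodular f) (hmono : MonotoneFn f)
    {S T : Finset α} (hST : S ⊆ T) (e : α) :
    f (insert e T) - f T ≤ f (insert e S) - f S := by
  by_cases he : e ∈ T
  · rw [Finset.insert_eq_of_mem he]
    have := hmono S (insert e S) (Finset.subset_insert e S)
    linarith
  · have h := hsub (insert e S) T
    have hunion : insert e S ∪ T = insert e T := by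
      rw [Finset.insert_union, Finset.union_eq_right.mpr hST]
    have hinter : insert e S ∩ T = S := by
      rw [Finset.insert_inter_of_notMem he, Finset.inter_eq_left.mpr hST]
    rw [hunion, hinter] at h
    linarith

theorem Submodular.union_le (hsub : Submodular f) (hmono : MonotoneFn f) (S X : Finset α) :
    f (S ∪ X) ≤ f S + ∑ e ∈ X, (f (insert e S) - f S) := by
  induction X using Finset.induction_on with
  | empty => simp
  | insert e X he ih =>
    rw [Finset.sum_insert he, Finset.union_insert]
    have := hsub.marginal_anti hmono (Finset.subset_union_left : S ⊆ S ∪ X) e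
    linarith

theorem HasCurvature.le_union {κ : ℝ} (hcurv : HasCurvature f κ) (S X : Finset α)
    (hdisj : Disjoint S X) : f S + (1 - κ) * ∑ e ∈ X, f {e} ≤ f (S ∪ X) := by
  induction X using Finset.induction_on with
  | empty => simp
  | insert e X he ih =>
    rw [Finset.disjoint_insert_right] at hdisj
    rw [Finset.sum_insert he, Finset.union_insert, mul_add]
    have := hcurv (S ∪ X) e (by simp [hdisj.1, he])
    linarith [ih hdisj.2]

end SetFunction

section Matching

variable {V : Type*} [DecidableEq V]

theorem degIn_mono {S T : Finset (Sym2 V)} (h : S ⊆ T) (v : V) : degIn S v ≤ degIn T v :=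
  Finset.card_le_card (Finset.filter_subset_filter _ h)

theorem Matching2.subset {S T : Finset (Sym2 V)} (hT : Matching2 T) (h : S ⊆ T) :
    Matching2 S :=
  ⟨fun e he => hT.1 e (h he), fun v => (degIn_mono h v).trans (hT.2 v)⟩

/-- At a single vertex, one removal from `R` makes room for the new edge `g`. -/
theorem exists_removal_at {R X : Finset (Sym2 V)} {g : Sym2 V}
    (hdisj : Disjoint R X) (hRX : Matching2 (R ∪ X)) (hgX : Matching2 (insert g X)) (v : V) :
    ∃ Y ⊆ R, Y.card ≤ 1 ∧ degIn ((R \ Y) ∪ insert g X) v ≤ 2 := by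
  by_cases h : ∃ e ∈ R, v ∈ e
  · obtain ⟨e, heR, hve⟩ := h
    refine ⟨{e}, by simpa using heR, by simp, ?_⟩
    have hsub : ((R \ {e}) ∪ insert g X).filter (fun e => v ∈ e) ⊆
        insert g (((R ∪ X).filter (fun e => v ∈ e)).erase e) := by
      intro x hx
      have hne : x ∈ X → x ≠ e := by
        rintro hxX rfl
        exact Finset.disjoint_left.mp hdisj heR hxX
      simp only [Finset.mem_filter, Finset.mem_union, Finset.mem_sdiff, Finset.mem_insert,
        Finset.mem_singleton, Finset.mem_erase] at hx ⊢
      tauto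
    have hcard := (Finset.card_le_card hsub).trans (Finset.card_insert_le _ _)
    have hmem : e ∈ (R ∪ X).filter (fun e => v ∈ e) := by simp [heR, hve]
    rw [Finset.card_erase_of_mem hmem] at hcard
    have h2 := hRX.2 v
    have hpos := Finset.card_pos.mpr ⟨e, hmem⟩
    unfold degIn at h2 ⊢
    omega
  · push Not at h
    refine ⟨∅, by simp, by simp, le_trans ?_ (hgX.2 v)⟩
    apply Finset.card_le_card
    intro x hx
    simp only [Finset.mem_filter, Finset.mem_union, Finset.mem_sdiff] at hx ⊢
    have := h x
    tauto

/-- Two removals, one at each endpoint, make room for a new edge. -/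
theorem Matching2.exists_exchange {R X : Finset (Sym2 V)} {g : Sym2 V}
    (hdisj : Disjoint R X) (hRX : Matching2 (R ∪ X)) (hgX : Matching2 (insert g X)) :
    ∃ Y ⊆ R, Y.card ≤ 2 ∧ Matching2 ((R \ Y) ∪ insert g X) := by
  induction g using Sym2.ind with
  | _ a b =>
  obtain ⟨Ya, hYa, hca, hda⟩ := exists_removal_at hdisj hRX hgX a
  obtain ⟨Yb, hYb, hcb, hdb⟩ := exists_removal_at hdisj hRX hgX b
  refine ⟨Ya ∪ Yb, Finset.union_subset hYa hYb,
    (Finset.card_union_le _ _).trans (by omega), ?_, ?_⟩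
  · intro e he
    rcases Finset.mem_union.mp he with he | he
    · exact hRX.1 e (Finset.mem_union_left _ (Finset.mem_sdiff.mp he).1)
    · exact hgX.1 e he
  · intro v
    by_cases hva : v = a
    · subst hva
      refine (degIn_mono (Finset.union_subset_union_left ?_) v).trans hda
      exact Finset.sdiff_subset_sdiff le_rfl Finset.subset_union_left
    by_cases hvb : v = b
    · subst hvb
      refine (degIn_mono (Finset.union_subset_union_left ?_) v).trans hdb
      exact Finset.sdiff_subset_sdiff le_rfl Finset.subset_union_right
    refine le_trans (Finset.card_le_card ?_) (hRX.2 v)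
    intro x hx
    have hne : v ∈ x → x ≠ s(a, b) := by
      rintro hvx rfl
      simp [hva, hvb] at hvx
    simp only [Finset.mem_filter, Finset.mem_union, Finset.mem_sdiff, Finset.mem_insert] at hx ⊢
    tauto

end Matching

theorem List.toFinset_take_subset {α : Type*} [DecidableEq α] (l : List α) (t : ℕ) :
    (l.take t).toFinset ⊆ l.toFinset := by
  intro x hx
  simp only [List.mem_toFinset] at hx ⊢
  exact List.mem_of_mem_take hx

/-- Charging scheme: after `t` greedy steps, the edges of `Mstar` outside the greedy solution
that have been exchanged out are paid for twice by the gains `A` of the steps picking edges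
outside `Mstar`; the edges in `R` are still to be paid for. -/
theorem IsGreedySeq.exists_charging {V : Type*} [DecidableEq V]
    {w : Finset (Sym2 V) → ℝ} {l : List (Sym2 V)} {Mstar : Finset (Sym2 V)}
    (hsub : Submodular w) (hmono : MonotoneFn w) (hnorm : w ∅ = 0)
    (hgreedy : IsGreedySeq {S | Matching2 S} w l) (hMstar : Matching2 Mstar)
    (t : ℕ) (ht : t ≤ l.length) :
    ∃ (R : Finset (Sym2 V)) (A : ℝ), R ⊆ Mstar \ l.toFinset ∧
      Matching2 (R ∪ ((l.take t).toFinset ∪ (l.toFinset ∩ Mstar))) ∧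
      A ≤ w (l.take t).toFinset ∧
      A ≤ ∑ e ∈ (l.take t).toFinset \ Mstar, w {e} ∧
      ∑ e ∈ (Mstar \ l.toFinset) \ R, (w (insert e l.toFinset) - w l.toFinset) ≤ 2 * A := by
  induction t with
  | zero =>
    refine ⟨Mstar \ l.toFinset, 0, subset_rfl, ?_, by simp [hnorm], by simp, by simp⟩
    refine hMstar.subset fun x hx => ?_
    simp only [List.take_zero, List.toFinset_nil, Finset.mem_union, Finset.mem_sdiff,
      Finset.mem_inter, Finset.notMem_empty] at hx
    tauto
  | succ t ih =>
    obtain ⟨R, A, hR, hmatch, hAw, hAs, hsum⟩ := ih (by omega)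
    have htl : t < l.length := by omega
    have hchoice := hgreedy.greedy t htl
    have htake : (l.take (t + 1)).toFinset = insert (l.get ⟨t, htl⟩) (l.take t).toFinset := by
      rw [← List.take_concat_get' l t htl, List.toFinset_append, Finset.union_comm,
        Finset.insert_eq]
      rfl
    have hnew : l.get ⟨t, htl⟩ ∉ (l.take t).toFinset := by
      have hnd := hgreedy.nodup.sublist (List.take_sublist (t + 1) l)
      rw [← List.take_concat_get' l t htl, List.nodup_append] at hnd
      intro hmem
      exact hnd.2.2 _ (List.mem_toFinset.mp hmem) _ (List.mem_singleton_self _) rfl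
    have hgM : l.get ⟨t, htl⟩ ∈ l.toFinset := by simp
    rw [htake]
    set g := l.get ⟨t, htl⟩
    set M := l.toFinset
    set P := (l.take t).toFinset
    have hPM : P ⊆ M := l.toFinset_take_subset t
    have hM : Matching2 M := by simpa using hgreedy.indep l.length
    have hgain := hmono P (insert g P) (Finset.subset_insert g P)
    by_cases hg : g ∈ Mstar
    · refine ⟨R, A, hR, ?_, by linarith, ?_, hsum⟩
      · refine hmatch.subset fun x hx => ?_
        simp only [Finset.mem_union, Finset.mem_insert, Finset.mem_inter] at hx ⊢
        rcases hx with hx | (rfl | hx) | hx <;> tauto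
      · rwa [Finset.insert_sdiff_of_mem _ hg]
    · have hXM : insert g (P ∪ (M ∩ Mstar)) ⊆ M :=
        Finset.insert_subset hgM (Finset.union_subset hPM Finset.inter_subset_left)
      have hdisj : Disjoint R (P ∪ (M ∩ Mstar)) :=
        Finset.disjoint_left.mpr fun x hxR hx =>
          (Finset.mem_sdiff.mp (hR hxR)).2 (hXM (Finset.mem_insert_of_mem hx))
      obtain ⟨Y, hYR, hYcard, hY⟩ := Matching2.exists_exchange hdisj hmatch (hM.subset hXM)
      refine ⟨R \ Y, A + (w (insert g P) - w P), Finset.sdiff_subset.trans hR, ?_,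
        by linarith, ?_, ?_⟩
      · rwa [Finset.insert_union]
      · rw [Finset.insert_sdiff_of_notMem _ hg, Finset.sum_insert (by simp [hnew])]
        have := hsub.marginal_anti hmono (Finset.empty_subset P) g
        rw [hnorm, insert_empty_eq] at this
        linarith
      · have hsplit : (Mstar \ M) \ (R \ Y) = ((Mstar \ M) \ R) ∪ Y := by
          ext x
          have h1 := @hR x
          have h2 := @hYR x
          simp only [Finset.mem_union, Finset.mem_sdiff] at h1 ⊢
          tauto
        have hYdisj : Disjoint ((Mstar \ M) \ R) Y :=
          Finset.disjoint_of_subset_right hYR Finset.sdiff_disjoint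
        rw [hsplit, Finset.sum_union hYdisj]
        have hYsum : ∑ e ∈ Y, (w (insert e M) - w M) ≤ Y.card • (w (insert g P) - w P) := by
          refine Finset.sum_le_card_nsmul _ _ _ fun e he => ?_
          refine (hsub.marginal_anti hmono hPM e).trans (hchoice e ?_ ?_)
          · exact fun heP => (Finset.mem_sdiff.mp (hR (hYR he))).2 (hPM heP)
          · refine hmatch.subset (Finset.insert_subset ?_ ?_)
            · exact Finset.mem_union_left _ (hYR he)
            · exact Finset.subset_union_left.trans Finset.subset_union_right
        rw [nsmul_eq_mul] at hYsum
        have hcard : (Y.card : ℝ) ≤ 2 := by exact_mod_cast hYcard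
        have := mul_le_mul_of_nonneg_right hcard (sub_nonneg.mpr hgain)
        linarith

/-- The greedy 2-matching is a `1/(2+κ)`-approximation to the maximum-reward
simple 2-matching. -/
theorem greedy_matching_approx {V : Type*} [Fintype V] [DecidableEq V]
    (w : Finset (Sym2 V) → ℝ) (κ : ℝ) (l : List (Sym2 V)) (Mstar : Finset (Sym2 V))
    (hnonneg : ∀ S : Finset (Sym2 V), 0 ≤ w S)
    (hsub : Submodular w) (hmono : MonotoneFn w) (hnorm : w ∅ = 0)
    (hκ0 : 0 ≤ κ) (hκ1 : κ ≤ 1) (hcurv : HasCurvature w κ)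
    (hgreedy : IsGreedySeq {S | Matching2 S} w l)
    (hMstar : Matching2 Mstar)
    (hMmax : ∀ M' : Finset (Sym2 V), Matching2 M' → w M' ≤ w Mstar) :
    w Mstar / (2 + κ) ≤ w l.toFinset := by
  obtain ⟨R, A, hR, hmatch, hAw, hAs, hsum⟩ :=
    hgreedy.exists_charging hsub hmono hnorm hMstar l.length le_rfl
  rw [List.take_length] at hmatch hAw hAs
  have hRempty : R = ∅ := by
    refine Finset.eq_empty_of_forall_notMem fun e he => ?_
    refine hgreedy.maximal e (Finset.mem_sdiff.mp (hR he)).2 (hmatch.subset ?_)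
    refine Finset.insert_subset (Finset.mem_union_left _ he) ?_
    exact Finset.subset_union_left.trans Finset.subset_union_right
  rw [hRempty, Finset.sdiff_empty] at hsum
  have hupper := hsub.union_le hmono l.toFinset (Mstar \ l.toFinset)
  have hlower := hcurv.le_union Mstar (l.toFinset \ Mstar) Finset.disjoint_sdiff
  rw [Finset.union_sdiff_self_eq_union] at hupper hlower
  rw [Finset.union_comm] at hlower
  have hcurvA := mul_le_mul_of_nonneg_left hAs (sub_nonneg.mpr hκ1)
  have hwA := mul_le_mul_of_nonneg_left hAw (by linarith : 0 ≤ 1 + κ)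
  rw [div_le_iff₀ (by linarith)]
  linarith
end

section
/- Let S be a finite set partitioned into pairwise disjoint nonempty parts A¹, …, Aᵐ with |Aⁱ| ≥ 3 for every i, and let k = min_i |Aⁱ|. Let f : 2^S → ℝ≥0 be a monotone nonnegative submodular function. Then there exists a choice of one element aⁱ ∈ Aⁱ from each part such that f( S \ {a¹, …, aᵐ} ) ≥ (1 − 1/k) · f(S) ≥ (2/3) · f(S). -/
/-- Removing pairwise disjoint sets one at a time from `S` costs, in total, at most as much as
removing their union. -/
theorem Submodular.sum_sub_sdiff_le {α ι : Type*} [DecidableEq α]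
    {f : Finset α → ℝ} (hf : Submodular f) (S : Finset α) (R : ι → Finset α)
    (hR : Pairwise fun i j => Disjoint (R i) (R j)) (J : Finset ι) :
    ∑ j ∈ J, (f S - f (S \ R j)) ≤ f S - f (S \ J.biUnion R) := by
  classical
  induction J using Finset.induction_on with
  | empty => simp
  | insert j J hj ih =>
    rw [Finset.sum_insert hj, Finset.biUnion_insert]
    have hd : Disjoint (R j) (J.biUnion R) :=
      (Finset.disjoint_biUnion_right _ _ _).2 fun i hi => hR fun h => hj (h ▸ hi)
    have h := hf (S \ R j) (S \ J.biUnion R)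
    rw [← Finset.sdiff_inter_distrib_right, Finset.disjoint_iff_inter_eq_empty.1 hd,
      Finset.sdiff_empty, ← Finset.sdiff_union_distrib] at h
    linarith

/-- Among `k` pairwise disjoint sets, one can be removed while losing at most a `1 / k` fraction
of the value of a nonnegative submodular function. -/
theorem Submodular.exists_le_sdiff {α : Type*} [DecidableEq α]
    {f : Finset α → ℝ} (hf : Submodular f) (hnonneg : ∀ X, 0 ≤ f X) (S : Finset α)
    {k : ℕ} (hk : 0 < k) (R : Fin k → Finset α)
    (hR : Pairwise fun i j => Disjoint (R i) (R j)) :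
    ∃ j, (1 - 1 / (k : ℝ)) * f S ≤ f (S \ R j) := by
  have hk' : (0 : ℝ) < k := by exact_mod_cast hk
  have : Nonempty (Fin k) := ⟨⟨0, hk⟩⟩
  obtain ⟨j, -, hj⟩ := Finset.exists_le_of_sum_le (s := Finset.univ)
    (f := fun j => f S - f (S \ R j)) (g := fun _ => f S / k) Finset.univ_nonempty (by
      have h := hf.sum_sub_sdiff_le S R hR Finset.univ
      have h0 := hnonneg (S \ Finset.univ.biUnion R)
      have hc : ∑ _j : Fin k, f S / k = f S := by
        rw [Finset.sum_const, Finset.card_univ, Fintype.card_fin, nsmul_eq_mul,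
          mul_div_cancel₀ _ hk'.ne']
      rw [hc]
      linarith)
  refine ⟨j, ?_⟩
  have : (1 - 1 / (k : ℝ)) * f S = f S - f S / k := by ring
  linarith

/-- If `S` is partitioned into parts `A¹, …, Aᵐ` each of size at least `3`, with `k` the
minimum part size, then one element can be removed from each part while keeping at least
a `(1 − 1/k) ≥ 2/3` fraction of the value of a monotone nonnegative submodular `f`. -/
theorem exists_transversal_removal {α : Type*} [DecidableEq α]
    (S : Finset α) (m : ℕ) (A : Fin m → Finset α) (k : ℕ)
    (f : Finset α → ℝ)
    (hsub : Submodular f) (hmono : MonotoneFn f)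
    (hnonneg : ∀ X : Finset α, 0 ≤ f X)
    (hcover : S = Finset.univ.biUnion A)
    (hdisj : ∀ i j, i ≠ j → Disjoint (A i) (A j))
    (hsize : ∀ i, 3 ≤ (A i).card)
    (hk_le : ∀ i, k ≤ (A i).card) (hk_eq : ∃ i, (A i).card = k) :
    ∃ a : Fin m → α, (∀ i, a i ∈ A i) ∧
      (1 - 1 / (k : ℝ)) * f S ≤ f (S \ Finset.image a Finset.univ) ∧
      (2 / 3 : ℝ) * f S ≤ (1 - 1 / (k : ℝ)) * f S := by
  have hk : 3 ≤ k := by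
    obtain ⟨i, hi⟩ := hk_eq
    exact hi ▸ hsize i
  have hemb : ∀ i, ∃ e : Fin k → α, Function.Injective e ∧ ∀ j, e j ∈ A i := fun i =>
    ⟨fun j => (A i).equivFin.symm (Fin.castLE (hk_le i) j),
      Subtype.val_injective.comp
        ((A i).equivFin.symm.injective.comp (Fin.castLE_injective (hk_le i))),
      fun j => Subtype.coe_prop _⟩
  choose e he_inj he_mem using hemb
  obtain ⟨j, hj⟩ := hsub.exists_le_sdiff hnonneg S (by omega : 0 < k)
    (fun j => Finset.univ.image fun i => e i j) (by
      intro j j' hjj'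
      simp only [Finset.disjoint_left, Finset.mem_image, Finset.mem_univ, true_and]
      rintro _ ⟨i, rfl⟩ ⟨i', h⟩
      obtain rfl | hii' := eq_or_ne i i'
      · exact hjj' (he_inj i h).symm
      · exact Finset.disjoint_left.1 (hdisj i i' hii') (he_mem i j) (h ▸ he_mem i' j'))
  refine ⟨fun i => e i j, fun i => he_mem i j, hj,
    mul_le_mul_of_nonneg_right ?_ (hnonneg S)⟩
  have h3 : (3 : ℝ) ≤ k := by exact_mod_cast hk
  have := one_div_le_one_div_of_le (by norm_num) h3
  linarith
end

section
/- Let (E, ℱ) be a p-system (p ≥ 1), let f = f₁ − f₂ where f₁ : 2^E → ℝ≥0 is monotone, normalized, nonnegative and submodular and f₂ is modular (f₂(X) = Σ_{e∈X} f₂({e})) and nonnegative, and let M = max_{e ∈ E} f₂({e}) and f'(X) = f(X) + |X|·M. Let n be the size of a maximum-cardinality basis of E, let T_G be the final set of any greedy sequence for (ℱ, f'), and let Z maximize f over ℱ (with Z a basis of E). Then f(T_G) ≥ (1/(p+1)) · f(Z) − M·n·( 1 + (p − 2)/(p(p+1)) ). -/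
/-- An independence system: a nonempty family of finite sets closed under subsets. -/
def IsIndepSystem {α : Type*} (ℱ : Set (Finset α)) : Prop :=
  ℱ.Nonempty ∧ ∀ A ∈ ℱ, ∀ B : Finset α, B ⊆ A → B ∈ ℱ

/-- `ℱ` is a `p`-system. -/
def IsPSystem {α : Type*} (ℱ : Set (Finset α)) (p : ℝ) : Prop :=
  ∀ A B₁ B₂ : Finset α, IsBasisOf ℱ A B₁ → IsBasisOf ℱ A B₂ →
    (B₁.card : ℝ) ≤ p * (B₂.card : ℝ)

section GreedyPSystem

variable {α : Type*} [DecidableEq α]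

theorem Submodular.marginal_le {f : Finset α → ℝ} (hsub : Submodular f) (hmono : MonotoneFn f)
    {S T : Finset α} (hST : S ⊆ T) (e : α) :
    f (insert e T) - f T ≤ f (insert e S) - f S := by
  have h := hsub (insert e S) T
  have hunion : insert e S ∪ T = insert e T := by
    rw [Finset.insert_union, Finset.union_eq_right.2 hST]
  have hinter : f S ≤ f (insert e S ∩ T) :=
    hmono _ _ (Finset.subset_inter (Finset.subset_insert e S) hST)
  rw [hunion] at h
  linarith

theorem Submodular.union_le_add_sum {f : Finset α → ℝ} (hsub : Submodular f)
    (hmono : MonotoneFn f) (T Z : Finset α) :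
    f (T ∪ Z) ≤ f T + ∑ z ∈ Z, (f (insert z T) - f T) := by
  induction Z using Finset.induction_on with
  | empty => simp
  | insert a s ha ih =>
    have h := hsub.marginal_le hmono (Finset.subset_union_left (s₁ := T) (s₂ := s)) a
    rw [Finset.sum_insert ha, Finset.union_insert]
    linarith

theorem exists_isBasisOf_superset {ℱ : Set (Finset α)} {A S : Finset α} (hS : S ∈ ℱ)
    (hSA : S ⊆ A) : ∃ B, IsBasisOf ℱ A B ∧ S ⊆ B := by
  classical
  obtain ⟨B, hB, hBmax⟩ := Finset.exists_max_image
    (A.powerset.filter fun B => B ∈ ℱ ∧ S ⊆ B) Finset.card ⟨S, by simp [hS, hSA]⟩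
  simp only [Finset.mem_filter, Finset.mem_powerset] at hB hBmax
  refine ⟨B, ⟨hB.2.1, hB.1, fun B' hB' hB'A hBB' => ?_⟩, hB.2.2⟩
  exact (Finset.eq_of_subset_of_card_le hBB'
    (hBmax B' ⟨hB'A, hB', hB.2.2.trans hBB'⟩)).symm

theorem isBasisOf_of_forall_insert_notMem {ℱ : Set (Finset α)} (hsys : IsIndepSystem ℱ)
    {A B : Finset α} (hB : B ∈ ℱ) (hBA : B ⊆ A)
    (hmax : ∀ e ∈ A, e ∉ B → insert e B ∉ ℱ) : IsBasisOf ℱ A B := by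
  refine ⟨hB, hBA, fun B' hB' hB'A hBB' => Finset.Subset.antisymm (fun e he => ?_) hBB'⟩
  by_contra heB
  exact hmax e (hB'A he) heB (hsys.2 B' hB' _ (Finset.insert_subset he hBB'))

/-- In a `p`-system, at most `p * |T|` elements of an independent set are blocked by an
independent set `T`. -/
theorem IsPSystem.card_le_of_blocked {ℱ : Set (Finset α)} {p : ℝ} (hpsys : IsPSystem ℱ p)
    (hsys : IsIndepSystem ℱ) {T A : Finset α} (hT : T ∈ ℱ) (hA : A ∈ ℱ)
    (hblocked : ∀ z ∈ A, z ∈ T ∨ insert z T ∉ ℱ) : (A.card : ℝ) ≤ p * T.card := by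
  obtain ⟨B, hB, hAB⟩ := exists_isBasisOf_superset hA (Finset.subset_union_right (s₁ := T))
  have hTbasis : IsBasisOf ℱ (T ∪ A) T :=
    isBasisOf_of_forall_insert_notMem hsys hT Finset.subset_union_left fun e he heT =>
      (hblocked e ((Finset.mem_union.1 he).resolve_left heT)).resolve_left heT
  have hcard : (A.card : ℝ) ≤ B.card := by exact_mod_cast Finset.card_le_card hAB
  exact hcard.trans (hpsys _ _ _ hB hTbasis)

theorem toFinset_take_succ (l : List α) {t : ℕ} (ht : t < l.length) :
    (l.take (t + 1)).toFinset = insert (l.get ⟨t, ht⟩) (l.take t).toFinset := by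
  rw [← List.take_append_getElem ht, List.toFinset_append, Finset.union_comm]
  simp

theorem IsGreedySeq.gain_le {ℱ : Set (Finset α)} {f : Finset α → ℝ} {l : List α}
    (hl : IsGreedySeq ℱ f l) (hmono : MonotoneFn f) {t : ℕ} (ht : t < l.length) {e : α}
    (he : insert e (l.take t).toFinset ∈ ℱ) :
    f (insert e (l.take t).toFinset) - f (l.take t).toFinset ≤
      f (l.take (t + 1)).toFinset - f (l.take t).toFinset := by
  rw [toFinset_take_succ l ht]
  by_cases hmem : e ∈ (l.take t).toFinset
  · rw [Finset.insert_eq_of_mem hmem]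
    exact sub_le_sub_right (hmono _ _ (Finset.subset_insert _ _)) _
  · exact hl.greedy t ht e hmem he

theorem IsGreedySeq.gain_antitone {ℱ : Set (Finset α)} {f : Finset α → ℝ} {l : List α}
    (hl : IsGreedySeq ℱ f l) (hsys : IsIndepSystem ℱ) (hsub : Submodular f)
    (hmono : MonotoneFn f) {t : ℕ} (ht : t < l.length) :
    f (l.take (t + 2)).toFinset - f (l.take (t + 1)).toFinset ≤
      f (l.take (t + 1)).toFinset - f (l.take t).toFinset := by
  have hsucc : (l.take t).toFinset ⊆ (l.take (t + 1)).toFinset := by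
    rw [toFinset_take_succ l ht]
    exact Finset.subset_insert _ _
  by_cases ht' : t + 1 < l.length
  · have hstep := toFinset_take_succ l ht'
    have hindep : insert (l.get ⟨t + 1, ht'⟩) (l.take t).toFinset ∈ ℱ := by
      refine hsys.2 _ (hl.indep (t + 2)) _ ?_
      rw [hstep]
      exact Finset.insert_subset_insert _ hsucc
    rw [hstep]
    exact (hsub.marginal_le hmono hsucc _).trans (hl.gain_le hmono ht hindep)
  · rw [List.take_of_length_le (show l.length ≤ t + 2 by omega),
      List.take_of_length_le (show l.length ≤ t + 1 by omega), sub_self, sub_nonneg]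
    refine hmono _ _ ?_
    rwa [List.take_of_length_le (show l.length ≤ t + 1 by omega)] at hsucc

/-- The greedy bound for monotone submodular maximization over a `p`-system. -/
theorem IsGreedySeq.le_mul {ℱ : Set (Finset α)} {f : Finset α → ℝ} {l : List α}
    (hl : IsGreedySeq ℱ f l) (hsys : IsIndepSystem ℱ) {p : ℝ} (hp : 0 ≤ p)
    (hpsys : IsPSystem ℱ p) (hsub : Submodular f) (hmono : MonotoneFn f) (hnorm : f ∅ = 0)
    {Z : Finset α} (hZ : Z ∈ ℱ) : f Z ≤ (p + 1) * f l.toFinset := by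
  classical
  set T : ℕ → Finset α := fun t => (l.take t).toFinset with hTdef
  set A : ℕ → Finset α := fun t => Z.filter fun z => z ∈ T t ∨ insert z (T t) ∉ ℱ with hAdef
  set g : α → ℝ := fun z => f (insert z l.toFinset) - f l.toFinset with hgdef
  have hTmono : ∀ t < l.length, T t ⊆ T (t + 1) := fun t ht => by
    simp only [hTdef, toFinset_take_succ l ht]
    exact Finset.subset_insert _ _
  have hAmono : ∀ t < l.length, A t ⊆ A (t + 1) := fun t ht z hz => by
    simp only [hAdef, Finset.mem_filter] at hz ⊢
    refine ⟨hz.1, hz.2.imp (fun h => hTmono t ht h) fun h h' => h ?_⟩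
    exact hsys.2 _ h' _ (Finset.insert_subset_insert _ (hTmono t ht))
  have hAcard : ∀ t, ((A t).card : ℝ) ≤ p * t := fun t => by
    have hTcard : ((T t).card : ℝ) ≤ t := by
      exact_mod_cast (List.toFinset_card_le _).trans (List.length_take_le _ _)
    refine (hpsys.card_le_of_blocked hsys (hl.indep t)
      (hsys.2 Z hZ _ (Finset.filter_subset _ _)) fun z hz => ?_).trans
        (mul_le_mul_of_nonneg_left hTcard hp)
    exact (Finset.mem_filter.1 hz).2
  have hTl : ∀ t, T t ⊆ l.toFinset := fun t z hz =>
    List.mem_toFinset.2 (List.mem_of_mem_take (List.mem_toFinset.1 hz))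
  have key : ∀ t ≤ l.length, ∑ z ∈ A t, g z
      + (p * t - (A t).card) * (f (T (t + 1)) - f (T t)) ≤ p * f (T t) := by
    intro t
    induction t with
    | zero =>
      intro _
      have hA0 : A 0 = ∅ := by
        refine Finset.filter_eq_empty_iff.2 fun z hz => ?_
        simpa [hTdef] using hsys.2 Z hZ {z} (Finset.singleton_subset_iff.2 hz)
      simp [hA0, hTdef, hnorm]
    | succ t ih =>
      intro ht
      have ht' : t < l.length := ht
      have hih := ih ht'.le
      have hnew : ∑ z ∈ A (t + 1) \ A t, g z ≤
          (A (t + 1) \ A t).card • (f (T (t + 1)) - f (T t)) := by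
        refine Finset.sum_le_card_nsmul _ _ _ fun z hz => ?_
        obtain ⟨hz₁, hz₂⟩ := Finset.mem_sdiff.1 hz
        have hzZ := (Finset.mem_filter.1 hz₁).1
        have hzℱ : insert z (T t) ∈ ℱ := by
          by_contra h
          exact hz₂ (Finset.mem_filter.2 ⟨hzZ, Or.inr h⟩)
        exact (hsub.marginal_le hmono (hTl t) z).trans (hl.gain_le hmono ht' hzℱ)
      rw [nsmul_eq_mul, Finset.cast_card_sdiff (hAmono t ht')] at hnew
      have hsum := Finset.sum_sdiff (f := g) (hAmono t ht')
      have hanti : f (T (t + 2)) - f (T (t + 1)) ≤ f (T (t + 1)) - f (T t) :=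
        hl.gain_antitone hsys hsub hmono ht'
      have hc := mul_le_mul_of_nonneg_left hanti (sub_nonneg.2 (hAcard (t + 1)))
      push_cast at hc ⊢
      linarith
  have hfinal := key l.length le_rfl
  have hTk : T l.length = l.toFinset := by simp [hTdef]
  have hTk' : T (l.length + 1) = l.toFinset := by
    simp only [hTdef, List.take_of_length_le (Nat.le_succ l.length)]
  have hAk : A l.length = Z := by
    refine Finset.filter_true_of_mem fun z _ => ?_
    rw [hTk]
    exact or_iff_not_imp_left.2 (hl.maximal z)
  rw [hTk, hTk', hAk, sub_self, mul_zero, add_zero] at hfinal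
  have hunion := hsub.union_le_add_sum hmono l.toFinset Z
  have hZle := hmono Z (l.toFinset ∪ Z) Finset.subset_union_right
  linarith

end GreedyPSystem

/-- Greedy maximization of the shifted function `f' = f + |·|·M`, where `f = f₁ − f₂`
with `f₁` monotone normalized nonnegative submodular and `f₂` modular nonnegative,
approximates the optimum of `f` over a `p`-system up to the stated additive error. -/
theorem greedy_modular_cost_approx {E : Type*} [DecidableEq E] [Fintype E]
    (ℱ : Set (Finset E)) (hsys : IsIndepSystem ℱ)
    (p : ℝ) (hp : 1 ≤ p) (hpsys : IsPSystem ℱ p)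
    (f₁ f₂ f f' : Finset E → ℝ)
    (hsub : Submodular f₁) (hmono : MonotoneFn f₁) (hnorm : f₁ ∅ = 0)
    (hf₁nonneg : ∀ X : Finset E, 0 ≤ f₁ X)
    (hf₂mod : ∀ X : Finset E, f₂ X = ∑ e ∈ X, f₂ {e})
    (hf₂nonneg : ∀ X : Finset E, 0 ≤ f₂ X)
    (hf : ∀ X : Finset E, f X = f₁ X - f₂ X)
    (M : ℝ) (hM_ub : ∀ e : E, f₂ {e} ≤ M) (hM_mem : ∃ e : E, f₂ {e} = M)
    (hf' : ∀ X : Finset E, f' X = f X + (X.card : ℝ) * M)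
    (n : ℕ)
    (hn_ex : ∃ B : Finset E, IsBasisOf ℱ Finset.univ B ∧ B.card = n)
    (hn_max : ∀ B : Finset E, IsBasisOf ℱ Finset.univ B → B.card ≤ n)
    (l : List E) (hgreedy : IsGreedySeq ℱ f' l)
    (Z : Finset E) (hZ : IsBasisOf ℱ Finset.univ Z)
    (hZmax : ∀ X ∈ ℱ, f X ≤ f Z) :
    (1 / (p + 1)) * f Z - M * (n : ℝ) * (1 + (p - 2) / (p * (p + 1))) ≤ f l.toFinset := by
  have hsplit : ∀ X, f' X = f₁ X + ∑ e ∈ X, (M - f₂ {e}) := fun X => by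
    rw [hf', hf, Finset.sum_sub_distrib, ← hf₂mod, Finset.sum_const, nsmul_eq_mul]
    ring
  have hsub' : Submodular f' := fun S T => by
    have h := hsub S T
    have hmod := Finset.sum_union_inter (s₁ := S) (s₂ := T) (f := fun e => M - f₂ {e})
    simp only [hsplit]
    linarith
  have hmono' : MonotoneFn f' := fun S T hST => by
    rw [hsplit, hsplit]
    exact add_le_add (hmono S T hST) (Finset.sum_le_sum_of_subset_of_nonneg hST
      fun e _ _ => sub_nonneg.2 (hM_ub e))
  have hnorm' : f' ∅ = 0 := by simp [hsplit, hnorm]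
  have hM : 0 ≤ M := by
    obtain ⟨e, he⟩ := hM_mem
    exact he ▸ hf₂nonneg {e}
  have hgreedy_le := hgreedy.le_mul hsys (by linarith) hpsys hsub' hmono' hnorm' hZ.1
  rw [hf', hf'] at hgreedy_le
  have hTℱ : l.toFinset ∈ ℱ := by simpa using hgreedy.indep l.length
  have hTn : (l.toFinset.card : ℝ) ≤ n := by
    exact_mod_cast hn_max _ (isBasisOf_of_forall_insert_notMem hsys hTℱ
      (Finset.subset_univ _) fun e _ he => hgreedy.maximal e he)
  have hnZ : (n : ℝ) ≤ p * Z.card := by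
    obtain ⟨B, hB, rfl⟩ := hn_ex
    exact hpsys _ _ _ hB hZ
  have hp0 : 0 < p := by linarith
  have hp1 : 0 < p + 1 := by linarith
  have hn0 : (0 : ℝ) ≤ n := Nat.cast_nonneg n
  have hclear : p * f Z - M * n * (p * (p + 1) + (p - 2)) ≤ p * (p + 1) * f l.toFinset := by
    have h₁ := mul_le_mul_of_nonneg_left hgreedy_le hp0.le
    have h₂ := mul_le_mul_of_nonneg_left hTn (mul_nonneg (mul_nonneg hp0.le hp1.le) hM)
    have h₃ := mul_le_mul_of_nonneg_left hnZ hM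
    have h₄ := mul_nonneg (mul_nonneg hM hn0) (sub_nonneg.2 hp)
    linarith
  have hlhs : (1 / (p + 1)) * f Z - M * (n : ℝ) * (1 + (p - 2) / (p * (p + 1))) =
      (p * f Z - M * n * (p * (p + 1) + (p - 2))) / (p * (p + 1)) := by
    field_simp
  rw [hlhs, div_le_iff₀ (mul_pos hp0 hp1)]
  linarith
end
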